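/- arXiv:2412.05191 — 9 statements merged into one kernel-verified Lean document; each statement's English description precedes it below -/
import Mathlib

section
/- Let d > 0, g₀ > 0, α₀ ≥ 0, β₀ ≥ 0, and define for ρ > 0 the function λ₊(ρ) = ½[dρ² + g₀ − α₀ − β₀ + √((dρ² + g₀ − α₀ − β₀)² − 4(dρ²(g₀ − β₀) − α₀ g₀))]. Then the minimum wave speed of the go-or-grow model, c̄ = inf_{ρ>0} λ₊(ρ)/ρ, satisfies c̄ ≤ √(d g₀) = ½ · 2√(d g₀); that is, the linear spread rate of the go-or-grow model is at most half of the FKPP minimal wave speed c̄_FKPP = 2√(d g₀). -/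
/-- The linear spread rate c̄ = inf_{ρ>0} λ₊(ρ)/ρ of the go-or-grow
model (μ = 0) is at most √(d g₀), i.e., half of the FKPP minimal wave speed
c̄_FKPP = 2√(d g₀). -/
theorem goOrGrow_spread_rate_le_half_FKPP
    (d g₀ α₀ β₀ : ℝ) (hd : 0 < d) (hg : 0 < g₀) (hα : 0 ≤ α₀) (hβ : 0 ≤ β₀)
    (lam : ℝ → ℝ)
    (hlam : ∀ ρ : ℝ, 0 < ρ → lam ρ =
      (d * ρ ^ 2 + g₀ - α₀ - β₀ +
        Real.sqrt ((d * ρ ^ 2 + g₀ - α₀ - β₀) ^ 2 -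
          4 * (d * ρ ^ 2 * (g₀ - β₀) - α₀ * g₀))) / 2) :
    sInf {c : ℝ | ∃ ρ : ℝ, 0 < ρ ∧ c = lam ρ / ρ} ≤ Real.sqrt (d * g₀) ∧
      Real.sqrt (d * g₀) = (1 / 2) * (2 * Real.sqrt (d * g₀)) := by
  refine ⟨?_, by ring⟩
  apply csInf_le
  · refine ⟨0, ?_⟩
    rintro c ⟨ρ, hρ, rfl⟩
    apply div_nonneg _ hρ.le
    rw [hlam ρ hρ]
    have hx : 0 < d * ρ ^ 2 := by positivity
    generalize d * ρ ^ 2 = x at hx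
    by_cases hT : 0 ≤ x + g₀ - α₀ - β₀
    · have := Real.sqrt_nonneg ((x + g₀ - α₀ - β₀) ^ 2 - 4 * (x * (g₀ - β₀) - α₀ * g₀))
      linarith
    · have hdet : x * (g₀ - β₀) - α₀ * g₀ ≤ 0 := by
        by_cases hb : g₀ ≤ β₀
        · nlinarith [mul_nonneg hx.le (sub_nonneg.2 hb), mul_nonneg hα hg.le]
        · have hxa : x ≤ α₀ := by linarith
          nlinarith [mul_nonneg (sub_nonneg.2 hxa) hg.le, mul_nonneg hx.le hβ]
      have := Real.le_sqrt_of_sq_le (x := -(x + g₀ - α₀ - β₀))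
        (y := (x + g₀ - α₀ - β₀) ^ 2 - 4 * (x * (g₀ - β₀) - α₀ * g₀)) (by nlinarith)
      linarith
  · have hs : 0 < Real.sqrt (d * g₀) := Real.sqrt_pos.2 (by positivity)
    have hsq : Real.sqrt (d * g₀) ^ 2 = d * g₀ := Real.sq_sqrt (by positivity)
    have hρ : 0 < Real.sqrt (d * g₀) / d := by positivity
    refine ⟨Real.sqrt (d * g₀) / d, hρ, ?_⟩
    have hx : d * (Real.sqrt (d * g₀) / d) ^ 2 = g₀ := by
      rw [div_pow, hsq]; field_simp
    have hD : (g₀ + g₀ - α₀ - β₀) ^ 2 - 4 * (g₀ * (g₀ - β₀) - α₀ * g₀) = (α₀ + β₀) ^ 2 := by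
      ring
    rw [hlam _ hρ, hx, hD, Real.sqrt_sq (by positivity), eq_div_iff hρ.ne']
    rw [← mul_div_assoc, ← sq, hsq]
    field_simp
    ring
end

section
/- Let d > 0, μ ≥ 0, g₀ ∈ ℝ, α₀ > 0, β₀ > 0, and for ρ ≥ 0 define λ_A(ρ) = ½[dρ² + g₀ − μ − α₀ − β₀ + √((dρ² + g₀ − μ − α₀ − β₀)² + 4((g₀ − β₀)(μ + α₀ − dρ²) + α₀β₀))]. Then λ_A(ρ) > g₀ − β₀ for every ρ ≥ 0; consequently the eigenvector ν(ρ) = ((λ_A(ρ) − g₀ + β₀)/α₀, 1)ᵀ of the matrix A(ρ) = [[dρ² − μ − α₀, β₀], [α₀, g₀ − β₀]] is a strictly positive vector for all ρ ≥ 0. -/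
/-- λ_A(ρ) > g₀ − β₀ for every ρ ≥ 0, and hence both components of the
eigenvector ν(ρ) = ((λ_A(ρ) − g₀ + β₀)/α₀, 1)ᵀ are strictly positive for all ρ ≥ 0. -/
theorem goOrGrow_eigenvector_positive
    (d μ g₀ α₀ β₀ : ℝ) (hd : 0 < d) (hμ : 0 ≤ μ) (hα : 0 < α₀) (hβ : 0 < β₀)
    (lam : ℝ → ℝ)
    (hlam : ∀ ρ : ℝ, lam ρ = (d * ρ ^ 2 + g₀ - μ - α₀ - β₀ +
      Real.sqrt ((d * ρ ^ 2 + g₀ - μ - α₀ - β₀) ^ 2 +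
        4 * ((g₀ - β₀) * (μ + α₀ - d * ρ ^ 2) + α₀ * β₀))) / 2) :
    ∀ ρ : ℝ, 0 ≤ ρ →
      g₀ - β₀ < lam ρ ∧ 0 < (lam ρ - g₀ + β₀) / α₀ ∧ (0 : ℝ) < 1 := by
  intro ρ _
  have h1 : g₀ - β₀ - (d * ρ ^ 2 - μ - α₀) <
      Real.sqrt ((d * ρ ^ 2 + g₀ - μ - α₀ - β₀) ^ 2 +
        4 * ((g₀ - β₀) * (μ + α₀ - d * ρ ^ 2) + α₀ * β₀)) := by
    apply Real.lt_sqrt_of_sq_lt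
    have := mul_pos hα hβ
    linarith [this, show (d * ρ ^ 2 + g₀ - μ - α₀ - β₀) ^ 2 +
        4 * ((g₀ - β₀) * (μ + α₀ - d * ρ ^ 2) + α₀ * β₀) =
        (g₀ - β₀ - (d * ρ ^ 2 - μ - α₀)) ^ 2 + 4 * (α₀ * β₀) by ring]
  have h2 : g₀ - β₀ < lam ρ := by
    rw [hlam ρ]
    linarith
  exact ⟨h2, div_pos (by linarith) hα, one_pos⟩
end

section
/- Let A = [[k_u, k_v], [h_u, h_v]] be a real 2×2 matrix with tr A < 0 and det A > 0, let d_u > 0, and for ω ∈ ℝ set J(ω) = [[−d_u ω² + k_u, k_v], [h_u, h_v]]. Then there exists ω ∈ ℝ such that J(ω) has an eigenvalue with positive real part if and only if h_v > 0. (This is the autocatalysis condition for diffusion-driven instability in a reaction–diffusion equation coupled to an ODE.) -/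
/-- For the PDE–ODE system with kinetics Jacobian A = [[k_u,k_v],[h_u,h_v]]
stable (tr A < 0, det A > 0) and d_u > 0, there exists a mode ω such that the Fourier
symbol J(ω) = [[−d_u ω² + k_u, k_v],[h_u, h_v]] has an eigenvalue with positive real
part if and only if h_v > 0 (the autocatalysis condition). -/
theorem autocatalysis_iff_diffusion_driven_instability
    (ku kv hu hv du : ℝ) (hdu : 0 < du)
    (htr : ku + hv < 0) (hdet : 0 < ku * hv - kv * hu) :
    (∃ ω : ℝ, ∃ z : ℂ, 0 < z.re ∧ ∃ w : Fin 2 → ℂ, w ≠ 0 ∧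
        Matrix.mulVec
          !![((-(du * ω ^ 2) + ku : ℝ) : ℂ), ((kv : ℝ) : ℂ);
             ((hu : ℝ) : ℂ), ((hv : ℝ) : ℂ)] w = z • w) ↔ 0 < hv := by
  constructor
  · rintro ⟨ω, z, hz, w, hw, h⟩
    by_contra hv0
    push Not at hv0
    have h0 := congrFun h 0
    have h1 := congrFun h 1
    simp only [Matrix.mulVec, dotProduct, Fin.sum_univ_two, Matrix.of_apply, Matrix.cons_val_zero,
      Matrix.cons_val_one, Pi.smul_apply, smul_eq_mul] at h0 h1
    generalize ha : -(du * ω ^ 2) + ku = a at h0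
    have hq : 0 ≤ du * ω ^ 2 := by positivity
    have hT : a + hv < 0 := by linarith
    have hD : 0 < a * hv - kv * hu := by subst ha; nlinarith
    have hc : (z - a) * (z - hv) - kv * hu = 0 := by
      by_contra hne
      apply hw
      have e0 : ((z - a) * (z - hv) - kv * hu) * w 0 = 0 := by
        linear_combination (-(z - hv)) * h0 - kv * h1
      have e1 : ((z - a) * (z - hv) - kv * hu) * w 1 = 0 := by
        linear_combination (-(z - a)) * h1 - hu * h0
      ext i
      fin_cases i
      · simpa using (mul_eq_zero.mp e0).resolve_left hne
      · simpa using (mul_eq_zero.mp e1).resolve_left hne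
    have hre := congrArg Complex.re hc
    have him := congrArg Complex.im hc
    simp at hre him
    have hy : z.im * (2 * z.re - (a + hv)) = 0 := by linear_combination him
    have hy0 : z.im = 0 := by
      rcases mul_eq_zero.mp hy with h | h
      · exact h
      · linarith
    rw [hy0] at hre
    nlinarith [mul_pos hz (neg_pos.mpr hT), mul_pos hz hz]
  · intro hv0
    have hku : ku < 0 := by linarith
    have hhu : hu ≠ 0 := by
      rintro rfl
      nlinarith
    set q : ℝ := 2 * (ku * hv - kv * hu) / hv / du with hq
    have hqpos : 0 ≤ q := by positivity
    have hq2 : du * q * hv = 2 * (ku * hv - kv * hu) := by rw [hq]; field_simp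
    set T : ℝ := -(du * q) + ku + hv with hT
    set D : ℝ := (-(du * q) + ku) * hv - kv * hu with hD
    have hDneg : D < 0 := by rw [hD]; linarith
    have hs0 : 0 ≤ T ^ 2 - 4 * D := by nlinarith [sq_nonneg T]
    have hs := Real.sq_sqrt hs0
    have hsT : |T| < √(T ^ 2 - 4 * D) := by
      rw [← Real.sqrt_sq_eq_abs]
      exact Real.sqrt_lt_sqrt (sq_nonneg T) (by linarith)
    set r := √(T ^ 2 - 4 * D)
    have hpos : 0 < (T + r) / 2 := by linarith [neg_abs_le T]
    have hchar : ((T + r) / 2) ^ 2 - T * ((T + r) / 2) + D = 0 := by linear_combination hs / 4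
    generalize (T + r) / 2 = l at hpos hchar
    refine ⟨√q, (l : ℂ), by simpa using hpos, ![((l - hv : ℝ) : ℂ), (hu : ℂ)], ?_, ?_⟩
    · intro h
      have := congrFun h 1
      simp at this
      exact hhu this
    · rw [Real.sq_sqrt hqpos]
      ext i
      fin_cases i
      · simp [Matrix.mulVec, dotProduct, Fin.sum_univ_two]
        norm_cast
        rw [hT, hD] at hchar
        linear_combination -hchar
      · simp [Matrix.mulVec, dotProduct, Fin.sum_univ_two]
        ring
end

section
/- Let A = [[k_u, k_v], [h_u, h_v]] be a real 2×2 matrix with tr A < 0, det A > 0 and h_v > 0, let d_u > 0, set ω̄ = √(det A / (d_u h_v)), and for ω ≥ ω̄ define λ₁(ω) = ½[tr J(ω) + √(tr J(ω)² − 4 det J(ω))], where J(ω) = [[−d_u ω² + k_u, k_v], [h_u, h_v]]. Then: (i) λ₁(ω̄) = 0; (ii) λ₁ is strictly increasing on [ω̄, ∞); (iii) λ₁(ω) < h_v for all ω ≥ ω̄, and λ₁(ω) → h_v as ω → ∞. In particular, higher spatial modes are more unstable than smaller modes, and the growth rate saturates at a positive value. -/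
/-- For ω ≥ ω̄ = √(det A/(d_u h_v)), the unstable eigenvalue
λ₁(ω) = ½[tr J(ω) + √(tr J(ω)² − 4 det J(ω))] satisfies λ₁(ω̄) = 0, λ₁ is strictly
increasing on [ω̄, ∞), λ₁(ω) < h_v there, and λ₁(ω) → h_v as ω → ∞. -/
theorem unstable_eigenvalue_monotone_saturates
    (ku kv hu hv du : ℝ) (hdu : 0 < du)
    (htr : ku + hv < 0) (hdet : 0 < ku * hv - kv * hu) (hhv : 0 < hv)
    (ωbar : ℝ) (hωbar : ωbar = Real.sqrt ((ku * hv - kv * hu) / (du * hv)))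
    (lam1 : ℝ → ℝ)
    (hlam1 : ∀ ω : ℝ, ωbar ≤ ω → lam1 ω =
      ((-(du * ω ^ 2) + ku + hv) +
        Real.sqrt ((-(du * ω ^ 2) + ku + hv) ^ 2 -
          4 * (-(du * ω ^ 2 * hv) + (ku * hv - kv * hu)))) / 2) :
    lam1 ωbar = 0 ∧
      StrictMonoOn lam1 (Set.Ici ωbar) ∧
      (∀ ω : ℝ, ωbar ≤ ω → lam1 ω < hv) ∧
      Filter.Tendsto lam1 Filter.atTop (nhds hv) := by
  have hb0 : 0 ≤ ωbar := hωbar ▸ Real.sqrt_nonneg _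
  have hdh : 0 < du * hv := mul_pos hdu hhv
  have hb2 : du * ωbar ^ 2 * hv = ku * hv - kv * hu := by
    rw [hωbar, Real.sq_sqrt (div_pos hdet hdh).le]
    field_simp
  have hku : ku < 0 := by linarith
  have hp : 0 < -(kv * hu) := by nlinarith [mul_pos (neg_pos.2 hku) hhv]
  have key : ∀ ω, ωbar ≤ ω → 0 ≤ lam1 ω ∧
      (lam1 ω + du * ω ^ 2 - ku) * (hv - lam1 ω) = -(kv * hu) := by
    intro ω hω
    have hsq : ωbar ^ 2 ≤ ω ^ 2 := pow_le_pow_left₀ hb0 hω 2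
    have hs : ku * hv - kv * hu ≤ du * ω ^ 2 * hv := by
      rw [← hb2]; gcongr
    have hd : (-(du * ω ^ 2) + ku + hv) ^ 2 ≤ (-(du * ω ^ 2) + ku + hv) ^ 2 -
          4 * (-(du * ω ^ 2 * hv) + (ku * hv - kv * hu)) := by linarith
    have hR := Real.sq_sqrt ((sq_nonneg _).trans hd)
    have hT := Real.abs_le_sqrt hd
    have hl := hlam1 ω hω
    generalize Real.sqrt _ = R at hR hT hl
    have := neg_abs_le (-(du * ω ^ 2) + ku + hv)
    refine ⟨by linarith, ?_⟩
    rw [hl]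
    linear_combination (-1 / 4) * hR
  have hlt : ∀ ω : ℝ, ωbar ≤ ω → lam1 ω < hv := by
    intro ω hω
    obtain ⟨h0, h1⟩ := key ω hω
    have hs : 0 ≤ du * ω ^ 2 := by positivity
    have : 0 < hv - lam1 ω := by
      refine pos_of_mul_pos_right (a := lam1 ω + du * ω ^ 2 - ku) ?_ (by linarith)
      linarith
    linarith
  refine ⟨?_, ?_, hlt, ?_⟩
  · obtain ⟨h0, h1⟩ := key ωbar le_rfl
    have hs : 0 ≤ du * ωbar ^ 2 := by positivity
    have h2 : lam1 ωbar * (hv + ku - lam1 ωbar - du * ωbar ^ 2) = 0 := by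
      linear_combination h1 - hb2
    rcases mul_eq_zero.1 h2 with h | h
    · exact h
    · linarith
  · intro x hx y hy hxy
    rw [Set.mem_Ici] at hx hy
    obtain ⟨h0, h1⟩ := key x hx
    obtain ⟨h2, h3⟩ := key y hy
    have hl := hlt x hx
    have hs : 0 ≤ du * y ^ 2 := by positivity
    have hsq : x ^ 2 < y ^ 2 := pow_lt_pow_left₀ hxy (hb0.trans hx) two_ne_zero
    have hq : 0 < (du * (y ^ 2 - x ^ 2)) * (hv - lam1 x) :=
      mul_pos (mul_pos hdu (by linarith)) (by linarith)
    have he : (du * (y ^ 2 - x ^ 2)) * (hv - lam1 x) =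
        (lam1 y - lam1 x) * (lam1 x + lam1 y + du * y ^ 2 - (ku + hv)) := by
      linear_combination h3 - h1
    rw [he] at hq
    have := pos_of_mul_pos_left hq (by linarith)
    linarith
  · have ht : Filter.Tendsto (fun ω : ℝ => hv - -(kv * hu) / (du * ω ^ 2))
        Filter.atTop (nhds hv) := by
      have h1 : Filter.Tendsto (fun ω : ℝ => du * ω ^ 2) Filter.atTop Filter.atTop :=
        (Filter.tendsto_pow_atTop two_ne_zero).const_mul_atTop hdu
      simpa using (h1.const_div_atTop (-(kv * hu))).const_sub hv
    refine tendsto_of_tendsto_of_tendsto_of_le_of_le' ht tendsto_const_nhds ?_ ?_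
    · filter_upwards [Filter.eventually_ge_atTop ωbar, Filter.eventually_gt_atTop 0] with ω hω hpos
      obtain ⟨h0, h1⟩ := key ω hω
      have hl := hlt ω hω
      have hs : 0 < du * ω ^ 2 := by positivity
      have : hv - lam1 ω ≤ -(kv * hu) / (du * ω ^ 2) := by
        rw [le_div_iff₀ hs, ← h1, mul_comm]
        exact mul_le_mul_of_nonneg_right (by linarith) (by linarith)
      linarith
    · filter_upwards [Filter.eventually_ge_atTop ωbar] with ω hω
      exact (hlt ω hω).le
end

section
/- Let γ > 0, let Γ : ℝ → ℝ and g : ℝ → ℝ be differentiable with g(1) = 0, and define the kinetics of the balanced go-or-grow model with μ = 0 by k(u,v) = γ[Γ(u+v)v − (1 − Γ(u+v))u] and h(u,v) = g(u+v)v − γ[Γ(u+v)v − (1 − Γ(u+v))u]. Then (ū, v̄) = (Γ(1), 1 − Γ(1)) is an equilibrium of the kinetics (k(ū,v̄) = h(ū,v̄) = 0), and the autocatalysis condition ∂h/∂v(ū, v̄) > 0 holds if and only if γ(Γ(1) + Γ'(1)) − g'(1)(1 − Γ(1)) < 0. -/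
/-- For the balanced go-or-grow kinetics (μ = 0), the point
(Γ(1), 1 − Γ(1)) is an equilibrium, and the autocatalysis condition ∂h/∂v > 0 there
holds iff γ(Γ(1) + Γ'(1)) − g'(1)(1 − Γ(1)) < 0. -/
theorem balanced_goOrGrow_autocatalysis
    (γ : ℝ) (hγ : 0 < γ) (Γ g : ℝ → ℝ)
    (hΓ : Differentiable ℝ Γ) (hg : Differentiable ℝ g) (hg1 : g 1 = 0)
    (k h : ℝ → ℝ → ℝ)
    (hk : ∀ u v : ℝ, k u v = γ * (Γ (u + v) * v - (1 - Γ (u + v)) * u))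
    (hh : ∀ u v : ℝ, h u v = g (u + v) * v - γ * (Γ (u + v) * v - (1 - Γ (u + v)) * u)) :
    k (Γ 1) (1 - Γ 1) = 0 ∧ h (Γ 1) (1 - Γ 1) = 0 ∧
      (0 < deriv (fun v => h (Γ 1) v) (1 - Γ 1) ↔
        γ * (Γ 1 + deriv Γ 1) - deriv g 1 * (1 - Γ 1) < 0) := by
  have e : Γ 1 + (1 - Γ 1) = 1 := by ring
  refine ⟨by rw [hk, e]; ring, by rw [hh, e, hg1]; ring, ?_⟩
  have hs : HasDerivAt (fun v : ℝ => Γ 1 + v) 1 (1 - Γ 1) :=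
    (hasDerivAt_id (1 - Γ 1)).const_add (Γ 1)
  have hi : HasDerivAt (fun v : ℝ => v) 1 (1 - Γ 1) := hasDerivAt_id (1 - Γ 1)
  have hG : HasDerivAt (fun v : ℝ => Γ (Γ 1 + v)) (deriv Γ 1 * 1) (1 - Γ 1) :=
    HasDerivAt.comp (h₂ := Γ) (1 - Γ 1) (by rw [e]; exact (hΓ 1).hasDerivAt) hs
  have hgg : HasDerivAt (fun v : ℝ => g (Γ 1 + v)) (deriv g 1 * 1) (1 - Γ 1) :=
    HasDerivAt.comp (h₂ := g) (1 - Γ 1) (by rw [e]; exact (hg 1).hasDerivAt) hs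
  have hd : HasDerivAt (fun v => h (Γ 1) v)
      (deriv g 1 * (1 - Γ 1) - γ * (Γ 1 + deriv Γ 1)) (1 - Γ 1) := by
    simp only [hh]
    have := (hgg.fun_mul hi).fun_sub
      (((hG.fun_mul hi).fun_sub ((hG.const_sub 1).mul_const (Γ 1))).const_mul γ)
    refine this.congr_deriv ?_
    rw [e, hg1]
    ring
  rw [hd.deriv]
  constructor <;> intro _ <;> linarith
end

section
/- Let a ≥ 0 and define for ρ > 0 the function c(ρ) = [ρ² + 1 − 2a + √((ρ² + 1 − 2a)² − 4(1 − a)ρ² + 4a)] / (2ρ). Then c(1) = 1 and c(ρ) ≥ 1 for all ρ > 0; consequently, when α(0) = β(0) = a, the linear spread rate c̄ = inf_{ρ>0} c(ρ) of the total population go-or-grow model equals 1, attained at ρ = 1. -/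
/-- When α(0) = β(0) = a, the dispersion function
c(ρ) = [ρ² + 1 − 2a + √((ρ² + 1 − 2a)² − 4(1 − a)ρ² + 4a)]/(2ρ) satisfies c(1) = 1
and c(ρ) ≥ 1 for all ρ > 0, so the linear spread rate inf_{ρ>0} c(ρ) equals 1,
attained at ρ = 1. -/
theorem total_population_spread_rate_equal_rates
    (a : ℝ) (ha : 0 ≤ a) (c : ℝ → ℝ)
    (hc : ∀ ρ : ℝ, 0 < ρ → c ρ =
      (ρ ^ 2 + 1 - 2 * a +
        Real.sqrt ((ρ ^ 2 + 1 - 2 * a) ^ 2 - 4 * (1 - a) * ρ ^ 2 + 4 * a)) / (2 * ρ)) :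
    c 1 = 1 ∧ (∀ ρ : ℝ, 0 < ρ → 1 ≤ c ρ) ∧
      IsLeast {x : ℝ | ∃ ρ : ℝ, 0 < ρ ∧ c ρ = x} 1 := by
  have h1 : c 1 = 1 := by
    rw [hc 1 one_pos]
    have h : ((1:ℝ) ^ 2 + 1 - 2 * a) ^ 2 - 4 * (1 - a) * 1 ^ 2 + 4 * a = (2 * a) ^ 2 := by ring
    rw [h, Real.sqrt_sq (by positivity)]
    ring
  have h2 : ∀ ρ : ℝ, 0 < ρ → 1 ≤ c ρ := by
    intro ρ hρ
    rw [hc ρ hρ, le_div_iff₀ (by positivity)]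
    have h : 2 * ρ - (ρ ^ 2 + 1 - 2 * a) ≤
        Real.sqrt ((ρ ^ 2 + 1 - 2 * a) ^ 2 - 4 * (1 - a) * ρ ^ 2 + 4 * a) := by
      apply Real.le_sqrt_of_sq_le
      have h0 : 0 ≤ 4 * (ρ + a) * (ρ - 1) ^ 2 := by positivity
      linarith
    linarith
  refine ⟨h1, h2, ⟨1, one_pos, h1⟩, ?_⟩
  rintro x ⟨ρ, hρ, rfl⟩
  exact h2 ρ hρ
end

section
/- Let a ≥ 0 and define for ρ > 0 the function c(ρ) = [ρ² + 1 − a + √((ρ² + 1 − a)² − 4ρ² + 4a)] / (2ρ). Then inf_{ρ>0} c(ρ) = 1/√(1 + a); that is, when β(0) = 0 and α(0) = a, the linear spread rate of the total population go-or-grow model is c̄ = 1/√(1 + α(0)). -/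
/-- When β(0) = 0 and α(0) = a, the linear spread rate of the total
population go-or-grow model is inf_{ρ>0} c(ρ) = 1/√(1 + a), where
c(ρ) = [ρ² + 1 − a + √((ρ² + 1 − a)² − 4ρ² + 4a)]/(2ρ). -/
theorem total_population_spread_rate_beta_zero
    (a : ℝ) (ha : 0 ≤ a) (c : ℝ → ℝ)
    (hc : ∀ ρ : ℝ, 0 < ρ → c ρ =
      (ρ ^ 2 + 1 - a +
        Real.sqrt ((ρ ^ 2 + 1 - a) ^ 2 - 4 * ρ ^ 2 + 4 * a)) / (2 * ρ)) :
    IsGLB {x : ℝ | ∃ ρ : ℝ, 0 < ρ ∧ c ρ = x} (1 / Real.sqrt (1 + a)) := by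
  have hdisc : ∀ ρ : ℝ, (ρ ^ 2 + 1 - a) ^ 2 - 4 * ρ ^ 2 + 4 * a = (ρ ^ 2 - a - 1) ^ 2 := by
    intro ρ; ring
  obtain ⟨s, hs⟩ : ∃ s, s = Real.sqrt (1 + a) := ⟨_, rfl⟩
  have hs0 : 0 < s := by rw [hs]; exact Real.sqrt_pos.mpr (by linarith)
  have hs2 : s ^ 2 = 1 + a := by rw [hs]; exact Real.sq_sqrt (by linarith)
  rw [← hs]
  apply IsLeast.isGLB
  constructor
  · refine ⟨s, hs0, ?_⟩
    rw [hc s hs0, hdisc, Real.sqrt_sq_eq_abs, hs2]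
    have h1 : 1 + a - a - 1 = 0 := by ring
    rw [h1, abs_zero]
    field_simp
    ring
  · rintro x ⟨ρ, hρ, rfl⟩
    rw [hc ρ hρ, hdisc, Real.sqrt_sq_eq_abs, div_le_div_iff₀ hs0 (by linarith)]
    rcases le_total ρ s with h | h
    · have := neg_le_abs (ρ ^ 2 - a - 1)
      nlinarith
    · have := le_abs_self (ρ ^ 2 - a - 1)
      have h2 : 0 ≤ (ρ - s) * (s * ρ + a) :=
        mul_nonneg (by linarith) (by positivity)
      have h3 : (ρ - s) * (s * ρ + a) = s * (ρ ^ 2 - a) - ρ := by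
        linear_combination (-ρ) * hs2
      nlinarith
end

section
/- Let b ≥ 0 and define for ρ > 0 the function c(ρ) = [ρ² + 1 − b + √((ρ² + 1 − b)² − 4(1 − b)ρ²)] / (2ρ). Then: (1) if 0 ≤ b < 1, inf_{ρ>0} c(ρ) = √(1 − b); (2) if b ≥ 1, inf_{ρ>0} c(ρ) = 0. That is, when α(0) = 0 and β(0) = b, the linear spread rate of the total population go-or-grow model is c̄ = √(1 − β(0)) if β(0) < 1 and c̄ = 0 otherwise. -/
/-- When α(0) = 0 and β(0) = b, the linear spread rate of the total
population go-or-grow model is inf_{ρ>0} c(ρ) = √(1 − b) if 0 ≤ b < 1 and 0 if b ≥ 1,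
where c(ρ) = [ρ² + 1 − b + √((ρ² + 1 − b)² − 4(1 − b)ρ²)]/(2ρ). -/
theorem total_population_spread_rate_alpha_zero
    (b : ℝ) (hb : 0 ≤ b) (c : ℝ → ℝ)
    (hc : ∀ ρ : ℝ, 0 < ρ → c ρ =
      (ρ ^ 2 + 1 - b +
        Real.sqrt ((ρ ^ 2 + 1 - b) ^ 2 - 4 * (1 - b) * ρ ^ 2)) / (2 * ρ)) :
    (b < 1 → IsGLB {x : ℝ | ∃ ρ : ℝ, 0 < ρ ∧ c ρ = x} (Real.sqrt (1 - b))) ∧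
    (1 ≤ b → IsGLB {x : ℝ | ∃ ρ : ℝ, 0 < ρ ∧ c ρ = x} 0) := by
  have key : ∀ ρ : ℝ, 0 < ρ → c ρ = (ρ ^ 2 + (1 - b) + |ρ ^ 2 - (1 - b)|) / (2 * ρ) := by
    intro ρ hρ
    rw [hc ρ hρ, ← Real.sqrt_sq_eq_abs]
    congr 1
    have h : (ρ ^ 2 + 1 - b) ^ 2 - 4 * (1 - b) * ρ ^ 2 = (ρ ^ 2 - (1 - b)) ^ 2 := by ring
    rw [h]
    ring
  constructor
  · intro h1
    have ha : 0 < 1 - b := by linarith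
    have hs := Real.sqrt_pos.mpr ha
    have hsq := Real.sq_sqrt ha.le
    apply IsLeast.isGLB
    refine ⟨⟨Real.sqrt (1 - b), hs, ?_⟩, ?_⟩
    · rw [key _ hs, hsq, sub_self, abs_zero, div_eq_iff (by positivity)]
      nlinarith
    · rintro x ⟨ρ, hρ, rfl⟩
      rw [key ρ hρ, le_div_iff₀ (by positivity)]
      have := abs_nonneg (ρ ^ 2 - (1 - b))
      nlinarith [sq_nonneg (ρ - Real.sqrt (1 - b))]
  · intro h1
    have key2 : ∀ ρ : ℝ, 0 < ρ → c ρ = ρ := by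
      intro ρ hρ
      rw [key ρ hρ, abs_of_nonneg (by nlinarith [sq_nonneg ρ]), div_eq_iff (by positivity)]
      ring
    constructor
    · rintro x ⟨ρ, hρ, rfl⟩
      rw [key2 ρ hρ]
      exact hρ.le
    · intro y hy
      apply le_of_forall_pos_le_add
      intro ε hε
      rw [zero_add]
      exact hy ⟨ε, hε, key2 ε hε⟩
end

section
/- Let a ≥ 0, b ≥ 0 with a + b > 0, and define for ρ > 0 the function c(ρ) = [ρ² + 1 − a − b + √((ρ² + 1 − a − b)² − 4(1 − b)ρ² + 4a)] / (2ρ). Then c is differentiable at ρ = 1 and c'(1) = (b − a)/(a + b). In particular, when α(0) = β(0) the function c has a critical point at ρ = 1. -/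
/-- The dispersion function
c(ρ) = [ρ² + 1 − a − b + √((ρ² + 1 − a − b)² − 4(1 − b)ρ² + 4a)]/(2ρ) is
differentiable at ρ = 1 with c'(1) = (b − a)/(a + b); in particular when a = b it has
a critical point at ρ = 1. -/
theorem total_population_dispersion_derivative_at_one
    (a b : ℝ) (ha : 0 ≤ a) (hb : 0 ≤ b) (hab : 0 < a + b) (c : ℝ → ℝ)
    (hc : ∀ ρ : ℝ, 0 < ρ → c ρ =
      (ρ ^ 2 + 1 - a - b +
        Real.sqrt ((ρ ^ 2 + 1 - a - b) ^ 2 - 4 * (1 - b) * ρ ^ 2 + 4 * a)) / (2 * ρ)) :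
    HasDerivAt c ((b - a) / (a + b)) 1 ∧ (a = b → HasDerivAt c 0 1) := by
  have key : HasDerivAt c ((b - a) / (a + b)) 1 := by
    have hs : ((1:ℝ) ^ 2 + 1 - a - b) ^ 2 - 4 * (1 - b) * 1 ^ 2 + 4 * a = (a + b) ^ 2 := by ring
    have hsq : Real.sqrt (((1:ℝ) ^ 2 + 1 - a - b) ^ 2 - 4 * (1 - b) * 1 ^ 2 + 4 * a) = a + b := by
      rw [hs, Real.sqrt_sq hab.le]
    have h2 : HasDerivAt (fun ρ : ℝ => ρ ^ 2) 2 1 := by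
      simpa using hasDerivAt_pow 2 (1:ℝ)
    have hA : HasDerivAt (fun ρ : ℝ => ρ ^ 2 + 1 - a - b) 2 1 :=
      ((h2.add_const 1).sub_const a).sub_const b
    have hD : HasDerivAt
        (fun ρ : ℝ => (ρ ^ 2 + 1 - a - b) ^ 2 - 4 * (1 - b) * ρ ^ 2 + 4 * a)
        (4 * (b - a)) 1 := by
      have h := ((hA.fun_pow 2).fun_sub (h2.const_mul (4 * (1 - b)))).add_const (4 * a)
      refine h.congr_deriv ?_
      norm_num
      ring
    have hS := hD.sqrt (by rw [hs]; positivity)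
    have hL : HasDerivAt (fun ρ : ℝ => 2 * ρ) 2 1 := by
      simpa using (hasDerivAt_id (1:ℝ)).const_mul 2
    have hQ := (hA.fun_add hS).fun_div hL (by norm_num)
    have hQ' := hQ.congr_of_eventuallyEq (f₁ := c) (by
      filter_upwards [lt_mem_nhds (zero_lt_one : (0:ℝ) < 1)] with ρ hρ
      exact hc ρ hρ)
    refine hQ'.congr_deriv ?_
    rw [hsq]
    field_simp
    ring
  refine ⟨key, fun h => ?_⟩
  simpa [h] using key
end
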